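/- (The horofunction is surjective.) Let C ⊆ ℝ^d be a proper open convex cone and let φ be a dual lightcone point for C. Then for every t > 0 there exists x ∈ C with f_C(x) = 1 and ⟪φ, x⟫ = t; i.e. the restriction of the linear functional ⟪φ, ·⟫ to the Vinberg hypersurface S = {x ∈ C : f_C(x) = 1} takes every value in (0, ∞). -/

import Mathlib

open MeasureTheory Set
open scoped RealInnerProductSpace ENNReal

/-- A proper open convex cone in Euclidean space: a nonempty open convex set,
closed under positive scalar multiplication, whose closure contains no line. -/
structure IsProperOpenConvexCone {d : ℕ} (C : Set (EuclideanSpace ℝ (Fin d))) : Prop where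
  nonempty : C.Nonempty
  isOpen : IsOpen C
  convex : Convex ℝ C
  smul_mem : ∀ t : ℝ, 0 < t → ∀ x ∈ C, t • x ∈ C
  salient : closure C ∩ (-closure C) = {0}

/-- The dual cone of `C`: functionals (identified with vectors via the inner
product) that are nonnegative on the closure of `C`. -/
def dualConeSet {d : ℕ} (C : Set (EuclideanSpace ℝ (Fin d))) : Set (EuclideanSpace ℝ (Fin d)) :=
  {φ | ∀ x ∈ closure C, 0 ≤ ⟪φ, x⟫}

/-- The characteristic function of the cone `C`. -/
noncomputable def charFn {d : ℕ} (C : Set (EuclideanSpace ℝ (Fin d)))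
    (x : EuclideanSpace ℝ (Fin d)) : ℝ≥0∞ :=
  ∫⁻ φ in dualConeSet C, ENNReal.ofReal (Real.exp (-⟪φ, x⟫))

section Helpers

open Filter Topology

variable {d : ℕ} {C : Set (EuclideanSpace ℝ (Fin d))}

lemma dual_of_open {ψ : EuclideanSpace ℝ (Fin d)} (h : ∀ x ∈ C, 0 ≤ ⟪ψ, x⟫) :
    ψ ∈ dualConeSet C := by
  intro x hx
  have hcl : IsClosed {x : EuclideanSpace ℝ (Fin d) | 0 ≤ ⟪ψ, x⟫} :=
    isClosed_le continuous_const (by fun_prop)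
  exact closure_minimal (fun x hx => h x hx) hcl hx

lemma isClosed_dual : IsClosed (dualConeSet C) := by
  have : dualConeSet C = ⋂ x ∈ closure C, {ψ : EuclideanSpace ℝ (Fin d) | 0 ≤ ⟪ψ, x⟫} := by
    ext ψ; simp [dualConeSet]
  rw [this]
  exact isClosed_biInter fun x _ => isClosed_le continuous_const (by fun_prop)

lemma convex_dual : Convex ℝ (dualConeSet C) := by
  intro a ha b hb s t hs ht _ x hx
  rw [inner_add_left, inner_smul_left, inner_smul_left]
  have := ha x hx
  have := hb x hx
  simp only [conj_trivial]
  positivity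

lemma closure_cone_smul (hC : IsProperOpenConvexCone C) {r : ℝ} (hr : 0 ≤ r)
    {x : EuclideanSpace ℝ (Fin d)} (hx : x ∈ closure C) : r • x ∈ closure C := by
  rcases hr.eq_or_lt with rfl | hr
  · have : (0 : EuclideanSpace ℝ (Fin d)) ∈ closure C ∩ (-closure C) := by
      rw [hC.salient]; rfl
    simpa using this.1
  · exact map_mem_closure (f := fun y : EuclideanSpace ℝ (Fin d) => r • y)
      (continuous_const_smul r) hx (fun y hy => hC.smul_mem r hr y hy)

lemma add_mem_cone (hC : IsProperOpenConvexCone C) {x v : EuclideanSpace ℝ (Fin d)}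
    (hx : x ∈ C) (hv : v ∈ closure C) : x + v ∈ C := by
  have h1 : (1/2 : ℝ) • x + (1/2 : ℝ) • v ∈ interior C :=
    hC.convex.combo_interior_closure_mem_interior (by rwa [hC.isOpen.interior_eq]) hv
      (by norm_num) (by norm_num) (by norm_num)
  have h2 := hC.smul_mem 2 (by norm_num) _ (interior_subset h1)
  rw [← smul_add, smul_smul] at h2
  simpa using h2

/-- A linear functional bounded above on the cone is nonpositive on it. -/
lemma nonpos_of_bdd (hC : IsProperOpenConvexCone C) (f : StrongDual ℝ (EuclideanSpace ℝ (Fin d)))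
    (u : ℝ) (h : ∀ a ∈ C, f a ≤ u) : ∀ a ∈ C, f a ≤ 0 := by
  intro a ha
  by_contra! hp
  have h1 := h _ (hC.smul_mem ((|u| + 1) / f a) (by positivity) a ha)
  rw [map_smul, smul_eq_mul, div_mul_cancel₀ _ hp.ne'] at h1
  linarith [le_abs_self u]

lemma mem_closure_of_dual (hC : IsProperOpenConvexCone C) {w : EuclideanSpace ℝ (Fin d)}
    (h : ∀ ψ ∈ dualConeSet C, 0 ≤ ⟪ψ, w⟫) : w ∈ closure C := by
  by_contra hw
  obtain ⟨f, u, hf, hu⟩ := geometric_hahn_banach_closed_point hC.convex.closure isClosed_closure hw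
  have h0 := hf 0 (by simpa using closure_cone_smul hC le_rfl (subset_closure hC.nonempty.some_mem))
  have hn := nonpos_of_bdd hC f u (fun a ha => (hf a (subset_closure ha)).le)
  have := h (-(InnerProductSpace.toDual ℝ _).symm f) (dual_of_open (by
    intro x hx
    rw [inner_neg_left, InnerProductSpace.toDual_symm_apply]
    linarith [hn x hx]))
  rw [inner_neg_left, InnerProductSpace.toDual_symm_apply] at this
  simp at h0
  linarith

lemma exists_support (hC : IsProperOpenConvexCone C) {p : EuclideanSpace ℝ (Fin d)}
    (hp : p ∈ closure C) (hpC : p ∉ C) :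
    ∃ ψ ∈ dualConeSet C, ψ ≠ 0 ∧ ⟪ψ, p⟫ = 0 := by
  obtain ⟨f, hf⟩ := geometric_hahn_banach_open_point hC.convex hC.isOpen hpC
  have hn := nonpos_of_bdd hC f (f p) (fun a ha => (hf a ha).le)
  have hd : -(InnerProductSpace.toDual ℝ _).symm f ∈ dualConeSet C := dual_of_open (by
    intro x hx
    rw [inner_neg_left, InnerProductSpace.toDual_symm_apply]
    linarith [hn x hx])
  have h1 := hd p hp
  rw [inner_neg_left, InnerProductSpace.toDual_symm_apply] at h1
  have h2 : 0 ≤ f p := by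
    by_contra! hlt
    obtain ⟨a, ha⟩ := hC.nonempty
    have h3 := hf a ha
    have h4 := hf _ (hC.smul_mem (f p / f a) (div_pos_of_neg_of_neg hlt (by linarith)) a ha)
    rw [map_smul, smul_eq_mul, div_mul_cancel₀ _ (by linarith)] at h4
    exact lt_irrefl _ h4
  refine ⟨_, hd, ?_, ?_⟩
  · intro h0
    obtain ⟨a, ha⟩ := hC.nonempty
    have h3 := hf a ha
    have h5 : ⟪-(InnerProductSpace.toDual ℝ (EuclideanSpace ℝ (Fin d))).symm f, a⟫ = 0 := by
      rw [h0, inner_zero_left]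
    rw [inner_neg_left, InnerProductSpace.toDual_symm_apply] at h5
    linarith
  · rw [inner_neg_left, InnerProductSpace.toDual_symm_apply]
    linarith

lemma interior_dual (hC : IsProperOpenConvexCone C) : (interior (dualConeSet C)).Nonempty := by
  rw [convex_dual.interior_nonempty_iff_affineSpan_eq_top]
  have h0 : (0 : EuclideanSpace ℝ (Fin d)) ∈ dualConeSet C := by intro x _; simp
  by_contra hne
  have hs : Submodule.span ℝ (dualConeSet C) ≠ ⊤ := by
    intro h
    apply hne
    rw [← AffineSubspace.coe_eq_univ_iff, ← Set.insert_eq_of_mem h0, affineSpan_insert_zero, h]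
    rfl
  rw [Ne, ← Submodule.orthogonal_eq_bot_iff] at hs
  obtain ⟨w, hw, hw0⟩ := Submodule.exists_mem_ne_zero_of_ne_bot hs
  have hz : ∀ ψ ∈ dualConeSet C, ⟪ψ, w⟫ = 0 := fun ψ hψ =>
    (Submodule.mem_orthogonal _ _).1 hw ψ (Submodule.subset_span hψ)
  have : w ∈ closure C ∩ (-closure C) :=
    ⟨mem_closure_of_dual hC fun ψ hψ => (hz ψ hψ).ge,
      mem_closure_of_dual hC fun ψ hψ => by rw [inner_neg_right, hz ψ hψ, neg_zero]⟩
  rw [hC.salient] at this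
  exact hw0 this

lemma exp_le_bracket {c : ℝ} (hc : 0 < c) (m : ℕ) {n : ℝ} (hn : 0 ≤ n) :
    Real.exp (-(c * n)) ≤ (Real.exp c * m.factorial / c ^ m) * (1 + n) ^ (-(m : ℝ)) := by
  have h := Real.pow_div_factorial_le_exp (c * (1 + n)) (by positivity) m
  rw [Real.rpow_neg (by positivity), Real.rpow_natCast]
  have h2 : Real.exp (-(c * n)) = Real.exp c / Real.exp (c * (1 + n)) := by
    rw [← Real.exp_sub]; congr 1; ring
  rw [h2]
  have h3 : 0 < (c * (1 + n)) ^ m / m.factorial := by positivity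
  calc _ ≤ Real.exp c / ((c * (1 + n)) ^ m / m.factorial) := by gcongr
    _ = _ := by rw [mul_pow]; field_simp

lemma charFn_ne_top (hC : IsProperOpenConvexCone C) {x : EuclideanSpace ℝ (Fin d)}
    (hx : x ∈ C) : charFn C x ≠ ∞ := by
  obtain ⟨r, hr, hb⟩ := Metric.isOpen_iff.1 hC.isOpen x hx
  set c := r / 2 with hcdef
  have hc : 0 < c := by positivity
  have key : ∀ ψ ∈ dualConeSet C, c * ‖ψ‖ ≤ ⟪ψ, x⟫ := by
    intro ψ hψ
    by_cases h0 : ψ = 0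
    · simp [h0]
    have hn : 0 < ‖ψ‖ := norm_pos_iff.2 h0
    have hm : x - (c / ‖ψ‖) • ψ ∈ C := by
      apply hb
      rw [Metric.mem_ball, dist_eq_norm, sub_sub_cancel_left, norm_neg, norm_smul, Real.norm_eq_abs,
        abs_of_pos (by positivity), div_mul_cancel₀ _ hn.ne']
      linarith
    have := hψ _ (subset_closure hm)
    rw [inner_sub_right, inner_smul_right, real_inner_self_eq_norm_sq] at this
    have e : c / ‖ψ‖ * ‖ψ‖ ^ 2 = c * ‖ψ‖ := by field_simp
    linarith
  have hfin := finite_integral_one_add_norm (E := EuclideanSpace ℝ (Fin d))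
    (μ := volume) (r := ((d + 1 : ℕ) : ℝ)) (by simp)
  set K := Real.exp c * (d + 1).factorial / c ^ (d + 1) with hK
  have hle : charFn C x ≤ ∫⁻ ψ : EuclideanSpace ℝ (Fin d),
      ENNReal.ofReal K * ENNReal.ofReal ((1 + ‖ψ‖) ^ (-((d + 1 : ℕ) : ℝ))) := by
    refine le_trans (setLIntegral_mono' isClosed_dual.measurableSet fun ψ hψ => ?_)
      (setLIntegral_le_lintegral _ _)
    rw [← ENNReal.ofReal_mul (by positivity)]
    apply ENNReal.ofReal_le_ofReal
    exact (Real.exp_le_exp.2 (neg_le_neg (key ψ hψ))).trans (exp_le_bracket hc _ (norm_nonneg _))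
  rw [lintegral_const_mul' _ _ ENNReal.ofReal_ne_top] at hle
  exact ne_top_of_le_ne_top (ENNReal.mul_ne_top ENNReal.ofReal_ne_top hfin.ne) hle

lemma charFn_boundary (hC : IsProperOpenConvexCone C) {p : EuclideanSpace ℝ (Fin d)}
    (hp : p ∈ closure C) (hpC : p ∉ C) : charFn C p = ∞ := by
  obtain ⟨ψ, hψ, hψ0, hψp⟩ := exists_support hC hp hpC
  obtain ⟨c, hcint⟩ := interior_dual hC
  obtain ⟨r0, hr0, hb0⟩ := Metric.isOpen_iff.1 isOpen_interior c hcint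
  have hn : 0 < ‖ψ‖ := norm_pos_iff.2 hψ0
  set r := min r0 (‖ψ‖ / 2) with hr
  have hrpos : 0 < r := by positivity
  have hb : ∀ y ∈ Metric.ball c r, y ∈ dualConeSet C := fun y hy =>
    interior_subset (hb0 (Metric.ball_subset_ball (min_le_left _ _) hy))
  set B : ℕ → Set (EuclideanSpace ℝ (Fin d)) := fun n => Metric.ball (c + (n : ℝ) • ψ) r with hB
  have hy : ∀ n, ∀ y ∈ B n, y - (n : ℝ) • ψ ∈ Metric.ball c r := by
    intro n y hy
    rw [hB, Metric.mem_ball, dist_eq_norm] at hy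
    rw [Metric.mem_ball, dist_eq_norm]
    convert hy using 2
    abel
  have hsub : (⋃ n, B n) ⊆ dualConeSet C := by
    refine iUnion_subset fun n y hyn x hx => ?_
    have h1 := hb _ (hy n y hyn) x hx
    have h2 := hψ x hx
    rw [inner_sub_left, inner_smul_left] at h1
    simp only [conj_trivial] at h1
    have : 0 ≤ (n : ℝ) * ⟪ψ, x⟫ := by positivity
    linarith
  have hmeas : MeasurableSet (⋃ n, B n) := MeasurableSet.iUnion fun n => measurableSet_ball
  have hdisj : Pairwise (Function.onFun Disjoint B) := by
    intro m n hmn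
    apply Metric.ball_disjoint_ball
    rw [dist_add_left, dist_eq_norm, ← sub_smul, norm_smul]
    have h1 : (1 : ℝ) ≤ ‖(m : ℝ) - n‖ := by
      rw [Real.norm_eq_abs]
      have : (1 : ℤ) ≤ |(m : ℤ) - n| := Int.one_le_abs (by omega)
      exact_mod_cast this
    have h2 : r ≤ ‖ψ‖ / 2 := min_le_right _ _
    nlinarith
  have hvol : volume (⋃ n, B n) = ∞ := by
    rw [measure_iUnion hdisj (fun n => measurableSet_ball)]
    have : ∀ n, volume (B n) = volume (Metric.ball (0 : EuclideanSpace ℝ (Fin d)) r) := fun n =>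
      Measure.addHaar_ball_center _ _ _
    simp_rw [this]
    exact ENNReal.tsum_const_eq_top_of_ne_zero (Metric.measure_ball_pos _ _ hrpos).ne'
  set M := ⟪c, p⟫ + r * ‖p‖ with hM
  have hbd : ∀ y ∈ ⋃ n, B n, ENNReal.ofReal (Real.exp (-M)) ≤
      ENNReal.ofReal (Real.exp (-⟪y, p⟫)) := by
    intro y hyU
    obtain ⟨n, hyn⟩ := mem_iUnion.1 hyU
    apply ENNReal.ofReal_le_ofReal
    apply Real.exp_le_exp.2
    have h1 := hy n y hyn
    rw [Metric.mem_ball, dist_eq_norm] at h1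
    have h2 := real_inner_le_norm (y - (n : ℝ) • ψ - c) p
    have h3 : ‖y - (n : ℝ) • ψ - c‖ * ‖p‖ ≤ r * ‖p‖ := by gcongr
    rw [inner_sub_left, inner_sub_left, inner_smul_left, hψp] at h2
    simp only [mul_zero] at h2
    linarith
  have h1 : ∫⁻ _ in ⋃ n, B n, ENNReal.ofReal (Real.exp (-M)) ≤ charFn C p :=
    (setLIntegral_mono' hmeas hbd).trans (lintegral_mono_set hsub)
  rw [setLIntegral_const, hvol, ENNReal.mul_top (by simp [Real.exp_pos])] at h1
  exact top_le_iff.1 h1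

lemma inner_pos (hC : IsProperOpenConvexCone C) {φ x : EuclideanSpace ℝ (Fin d)}
    (hφ0 : φ ≠ 0) (hφK : ∀ x ∈ closure C, 0 ≤ ⟪φ, x⟫) (hx : x ∈ C) : 0 < ⟪φ, x⟫ := by
  obtain ⟨r, hr, hb⟩ := Metric.isOpen_iff.1 hC.isOpen x hx
  have hn : 0 < ‖φ‖ := norm_pos_iff.2 hφ0
  have hm : x - (r / 2 / ‖φ‖) • φ ∈ C := by
    apply hb
    rw [Metric.mem_ball, dist_eq_norm, sub_sub_cancel_left, norm_neg, norm_smul, Real.norm_eq_abs,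
      abs_of_pos (by positivity), div_mul_cancel₀ _ hn.ne']
    linarith
  have := hφK _ (subset_closure hm)
  rw [inner_sub_right, inner_smul_right, real_inner_self_eq_norm_sq] at this
  have : 0 < r / 2 / ‖φ‖ * ‖φ‖ ^ 2 := by positivity
  linarith

lemma meas_exp (x : EuclideanSpace ℝ (Fin d)) :
    Measurable fun ψ : EuclideanSpace ℝ (Fin d) => ENNReal.ofReal (Real.exp (-⟪ψ, x⟫)) := by
  have : Continuous fun ψ : EuclideanSpace ℝ (Fin d) => Real.exp (-⟪ψ, x⟫) := by fun_prop
  exact this.measurable.ennreal_ofReal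

/-- Dominated convergence along a ray in a direction of the closed cone. -/
lemma bound_ray {x v ψ : EuclideanSpace ℝ (Fin d)} (hv : v ∈ closure C) (hψ : ψ ∈ dualConeSet C)
    {s s1 : ℝ} (h : s1 ≤ s) : ENNReal.ofReal (Real.exp (-⟪ψ, x + s • v⟫)) ≤
      ENNReal.ofReal (Real.exp (-⟪ψ, x + s1 • v⟫)) := by
  apply ENNReal.ofReal_le_ofReal
  apply Real.exp_le_exp.2
  rw [inner_add_right, inner_add_right, inner_smul_right, inner_smul_right]
  have := hψ v hv
  nlinarith

lemma tendsto_ray_zero (hC : IsProperOpenConvexCone C) {x v : EuclideanSpace ℝ (Fin d)}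
    (hx : x ∈ C) (hv : v ∈ closure C) (hv0 : v ≠ 0) :
    Tendsto (fun s : ℝ => charFn C (x + s • v)) atTop (𝓝 0) := by
  have hae : ∀ᵐ ψ : EuclideanSpace ℝ (Fin d), ⟪ψ, v⟫ ≠ 0 := by
    have h := Measure.addHaar_submodule (volume : Measure (EuclideanSpace ℝ (Fin d)))
      ((ℝ ∙ v)ᗮ) (by
        intro h
        have : v ∈ (ℝ ∙ v)ᗮ := by rw [h]; trivial
        rw [Submodule.mem_orthogonal_singleton_iff_inner_right] at this
        exact hv0 (inner_self_eq_zero.1 this))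
    refine measure_mono_null (fun ψ hψ => ?_) h
    simp only [mem_compl_iff, mem_ofPred_eq, not_not] at hψ
    exact (Submodule.mem_orthogonal_singleton_iff_inner_left).2 hψ
  have := tendsto_lintegral_filter_of_dominated_convergence
    (μ := volume.restrict (dualConeSet C)) (l := (atTop : Filter ℝ))
    (F := fun s ψ => ENNReal.ofReal (Real.exp (-⟪ψ, x + s • v⟫))) (f := fun _ => 0)
    (fun ψ => ENNReal.ofReal (Real.exp (-⟪ψ, x + (0 : ℝ) • v⟫)))
    (Eventually.of_forall fun s => meas_exp _)
    (by
      filter_upwards [eventually_ge_atTop (0 : ℝ)] with s hs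
      filter_upwards [ae_restrict_mem isClosed_dual.measurableSet] with ψ hψ
      exact bound_ray hv hψ hs)
    (charFn_ne_top hC (by simpa using hx))
    (by
      filter_upwards [ae_restrict_mem isClosed_dual.measurableSet, ae_restrict_of_ae hae] with ψ hψ h0
      have hpos : 0 < ⟪ψ, v⟫ := lt_of_le_of_ne (hψ v hv) (Ne.symm h0)
      rw [← ENNReal.ofReal_zero]
      apply ENNReal.tendsto_ofReal
      apply Real.tendsto_exp_neg_atTop_nhds_zero.comp
      simp_rw [inner_add_right, inner_smul_right]
      exact tendsto_atTop_add_const_left _ _ (tendsto_id.atTop_mul_const hpos))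
  simpa [charFn] using this

lemma continuousOn_ray (hC : IsProperOpenConvexCone C) {x v : EuclideanSpace ℝ (Fin d)} {s1 : ℝ}
    (hx : x + s1 • v ∈ C) (hv : v ∈ closure C) :
    ContinuousOn (fun s : ℝ => charFn C (x + s • v)) (Ici s1) := by
  intro s hs
  refine tendsto_lintegral_filter_of_dominated_convergence
    (μ := volume.restrict (dualConeSet C)) (l := 𝓝[Ici s1] s)
    (F := fun s ψ => ENNReal.ofReal (Real.exp (-⟪ψ, x + s • v⟫)))
    (fun ψ => ENNReal.ofReal (Real.exp (-⟪ψ, x + s1 • v⟫)))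
    (Eventually.of_forall fun s => meas_exp _) ?_ (charFn_ne_top hC hx) ?_
  · filter_upwards [self_mem_nhdsWithin] with s hs
    filter_upwards [ae_restrict_mem isClosed_dual.measurableSet] with ψ hψ
    exact bound_ray hv hψ hs
  · refine Eventually.of_forall fun ψ => ?_
    apply ENNReal.tendsto_ofReal
    have : Continuous fun s : ℝ => Real.exp (-⟪ψ, x + s • v⟫) := by fun_prop
    exact this.continuousWithinAt

lemma exists_large (hC : IsProperOpenConvexCone C) {x v : EuclideanSpace ℝ (Fin d)} {a : ℝ}
    (hp : x + a • v ∈ closure C) (hpC : x + a • v ∉ C) :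
    ∃ s, a < s ∧ 1 < charFn C (x + s • v) := by
  by_contra! h
  have h1 := lintegral_liminf_le (μ := volume.restrict (dualConeSet C)) (u := 𝓝[>] a)
    (f := fun (s : ℝ) (ψ : EuclideanSpace ℝ (Fin d)) =>
      ENNReal.ofReal (Real.exp (-⟪ψ, x + s • v⟫))) (fun s => meas_exp _)
  have h2 : ∀ ψ : EuclideanSpace ℝ (Fin d),
      liminf (fun s : ℝ => ENNReal.ofReal (Real.exp (-⟪ψ, x + s • v⟫))) (𝓝[>] a) =
        ENNReal.ofReal (Real.exp (-⟪ψ, x + a • v⟫)) := by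
    intro ψ
    apply Tendsto.liminf_eq
    apply ENNReal.tendsto_ofReal
    have : Continuous fun s : ℝ => Real.exp (-⟪ψ, x + s • v⟫) := by fun_prop
    exact this.continuousWithinAt
  simp_rw [h2] at h1
  have h3 : liminf (fun s : ℝ => charFn C (x + s • v)) (𝓝[>] a) ≤ 1 := by
    refine (liminf_le_liminf (v := fun _ => (1 : ℝ≥0∞)) ?_).trans (by simp)
    filter_upwards [self_mem_nhdsWithin] with s hs using h s hs
  have h4 : charFn C (x + a • v) ≤ 1 := h1.trans h3
  rw [charFn_boundary hC hp hpC] at h4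
  exact absurd h4 (by simp)

lemma exists_exit (hC : IsProperOpenConvexCone C) {x v : EuclideanSpace ℝ (Fin d)}
    (hx : x ∈ C) (hv : v ∈ closure C) (hv0 : v ≠ 0) :
    ∃ a : ℝ, x + a • v ∈ closure C ∧ x + a • v ∉ C ∧ ∀ s, a < s → x + s • v ∈ C := by
  set S : Set ℝ := {s | x + s • v ∈ C} with hS
  have hcont : Continuous fun s : ℝ => x + s • v := by fun_prop
  have hSo : IsOpen S := hC.isOpen.preimage hcont
  have hup : ∀ s ∈ S, ∀ t, s ≤ t → t ∈ S := by
    intro s hs t hst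
    have := add_mem_cone hC hs (closure_cone_smul hC (sub_nonneg.2 hst) hv)
    rw [add_assoc, ← add_smul, add_sub_cancel] at this
    exact this
  have h0 : (0 : ℝ) ∈ S := by simpa [hS] using hx
  have hbdd : BddBelow S := by
    by_contra hnb
    have hall : ∀ t, t ∈ S := by
      intro t
      rw [not_bddBelow_iff] at hnb
      obtain ⟨s, hs, hst⟩ := hnb t
      exact hup s hs t hst.le
    have hmem : -v ∈ closure C := by
      have hlim : Tendsto (fun n : ℕ => (1 / ((n : ℝ) + 1)) • x + (-v)) atTop (𝓝 ((0 : ℝ) • x + (-v))) :=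
        (tendsto_one_div_add_atTop_nhds_zero_nat.smul_const x).add_const _
      rw [zero_smul, zero_add] at hlim
      refine mem_closure_of_tendsto hlim (Eventually.of_forall fun n => ?_)
      have hn : (0 : ℝ) < n + 1 := by positivity
      have := hC.smul_mem (1 / ((n : ℝ) + 1)) (by positivity) _ (hall (-((n : ℝ) + 1)))
      rw [smul_add, smul_smul] at this
      convert this using 2
      rw [mul_neg, one_div, inv_mul_cancel₀ hn.ne', neg_one_smul]
    have : v ∈ closure C ∩ (-closure C) := ⟨hv, hmem⟩
    rw [hC.salient] at this
    exact hv0 this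
  have hgt : ∀ s, sInf S < s → s ∈ S := by
    intro s hs
    obtain ⟨t, ht, hts⟩ := exists_lt_of_csInf_lt ⟨0, h0⟩ hs
    exact hup t ht s hts.le
  refine ⟨sInf S, ?_, ?_, hgt⟩
  · exact map_mem_closure (f := fun s : ℝ => x + s • v) hcont (csInf_mem_closure ⟨0, h0⟩ hbdd) (fun s hs => hs)
  · intro hin
    obtain ⟨ε, hε, hb⟩ := Metric.isOpen_iff.1 hSo _ (show sInf S ∈ S from hin)
    have : sInf S - ε / 2 ∈ S := hb (by
      rw [Metric.mem_ball, Real.dist_eq, sub_sub_cancel_left, abs_neg, abs_of_pos (by positivity)]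
      linarith)
    linarith [csInf_le hbdd this]

end Helpers

/-- The horofunction is surjective: the linear functional of a dual lightcone
point takes every positive value on the Vinberg hypersurface. -/
theorem horofunction_surjective {d : ℕ} (hd : 0 < d)
    (C : Set (EuclideanSpace ℝ (Fin d))) (hC : IsProperOpenConvexCone C)
    (φ : EuclideanSpace ℝ (Fin d)) (hφ0 : φ ≠ 0)
    (hφK : ∀ x ∈ closure C, 0 ≤ ⟪φ, x⟫)
    (hφL : ∃ v ∈ frontier C \ {0}, ⟪φ, v⟫ = 0)
    (t : ℝ) (ht : 0 < t) :
    ∃ x ∈ C, charFn C x = 1 ∧ ⟪φ, x⟫ = t := by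
  obtain ⟨v, ⟨hvf, hv0⟩, hφv⟩ := hφL
  have hv : v ∈ closure C := frontier_subset_closure hvf
  have hv0' : v ≠ 0 := hv0
  obtain ⟨y, hy⟩ := hC.nonempty
  have hφy := inner_pos hC hφ0 hφK hy
  have hx : (t / ⟪φ, y⟫) • y ∈ C := hC.smul_mem _ (by positivity) y hy
  have hφx : ⟪φ, (t / ⟪φ, y⟫) • y⟫ = t := by
    rw [inner_smul_right, div_mul_cancel₀ _ hφy.ne']
  generalize (t / ⟪φ, y⟫) • y = x at hx hφx
  obtain ⟨a, hp, hpC, hgt⟩ := exists_exit hC hx hv hv0'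
  obtain ⟨s1, has1, hs1⟩ := exists_large hC hp hpC
  obtain ⟨s2, hs2, hs12⟩ := (((tendsto_ray_zero hC hx hv hv0').eventually
    (gt_mem_nhds zero_lt_one)).and (Filter.eventually_ge_atTop s1)).exists
  have hcont := (continuousOn_ray hC (hgt s1 has1) hv).mono (Icc_subset_Ici_self : Icc s1 s2 ⊆ Ici s1)
  obtain ⟨s, hs, hs'⟩ := intermediate_value_Icc' hs12 hcont ⟨hs2.le, hs1.le⟩
  refine ⟨x + s • v, hgt s (has1.trans_le hs.1), hs', ?_⟩
  rw [inner_add_right, inner_smul_right, hφv, hφx, mul_zero, add_zero]
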